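/- Let n be a positive integer with n ≡ 4 (mod 9) or n ≡ 7 (mod 9). Then ∑_{k=0}^{n−1} (q^2;q^9)_k (q^2;q^9)_k (q^5;q^9)_k · q^{9k} / (q^9;q^9)_k^3 ≡ 0 (mod Φ_n(q)^2), as rational functions of q over ℚ. -/

import Mathlib

open Finset Polynomial

/-- The q-shifted factorial `(x; q)_k = ∏_{j=0}^{k-1} (1 - x q^j)` in `RatFunc ℚ`. -/
noncomputable def qPoch (x q : RatFunc ℚ) (k : ℕ) : RatFunc ℚ :=
  ∏ j ∈ Finset.range k, (1 - x * q ^ j)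

/-- `A ≡ 0 (mod P)`: `A = P · B` for some rational function `B` whose denominator
(in lowest terms) is coprime to `P`. -/
def CongrZero (A : RatFunc ℚ) (P : Polynomial ℚ) : Prop :=
  ∃ B : RatFunc ℚ, A = algebraMap (Polynomial ℚ) (RatFunc ℚ) P * B ∧ IsCoprime B.denom P

section Saalschutz

variable {K : Type*} [Field K]

/-- The `k`-th term of the balanced series
`₃φ₂(a, b, p^{-N}; p, a b p^{-N}; p, p)`, with negative powers of `p` cleared. -/
def saalschutzTerm (a b p : K) (N k : ℕ) : K :=
  ∏ j ∈ range k, (1 - a * p ^ j) * (1 - b * p ^ j) * (p ^ N - p ^ j) * p /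
    ((1 - p ^ (j + 1)) ^ 2 * (p ^ N - a * b * p ^ j))

theorem saalschutzTerm_succ (a b p : K) (N k : ℕ) :
    saalschutzTerm a b p N (k + 1) = saalschutzTerm a b p N k *
      ((1 - a * p ^ k) * (1 - b * p ^ k) * (p ^ N - p ^ k) * p /
        ((1 - p ^ (k + 1)) ^ 2 * (p ^ N - a * b * p ^ k))) :=
  prod_range_succ _ _

theorem saalschutzTerm_zero (a b p : K) (N : ℕ) : saalschutzTerm a b p N 0 = 1 :=
  prod_range_zero _

theorem saalschutzTerm_eq_zero (a b p : K) {N k : ℕ} (h : N < k) :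
    saalschutzTerm a b p N k = 0 :=
  prod_eq_zero (mem_range.2 h) (by simp)

variable {a b p : K} {M : ℕ}

theorem saalschutzTerm_succ_succ (hp0 : p ≠ 0) (hp : ∀ i : ℕ, 0 < i → 1 - p ^ i ≠ 0)
    (hab : ∀ N ≤ M, ∀ j, p ^ N - a * b * p ^ j ≠ 0) {N : ℕ} (hN : N + 1 ≤ M) (k : ℕ) :
    (1 - p ^ (N + 1)) * (a * b - p ^ (N + 1)) * saalschutzTerm a b p (N + 1) (k + 1) =
      (1 - p ^ (N + 1)) ^ 2 * ((1 - a * p ^ k) * (1 - b * p ^ k) * p / (1 - p ^ (k + 1)) ^ 2) *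
        saalschutzTerm a b p N k := by
  induction k with
  | zero =>
    have h1 := hab (N + 1) hN 0
    have h2 := hp 1 one_pos
    simp only [saalschutzTerm_succ, saalschutzTerm_zero, pow_zero, mul_one, zero_add, pow_one,
      one_mul] at h1 h2 ⊢
    field_simp
    ring
  | succ k ih =>
    rw [saalschutzTerm_succ, ← mul_assoc, ih, saalschutzTerm_succ]
    have h1 := hab (N + 1) hN (k + 1)
    have h1' : p ^ (N + 1) - a * b * p ^ (k + 1) = p * (p ^ N - a * b * p ^ k) := by ring
    have h2 := hp (k + 1) k.succ_pos
    have h3 := hp (k + 1 + 1) (k + 1).succ_pos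
    have h4 := hab N (by omega) k
    have h5 : p ^ (N + 1) - p ^ (k + 1) = p * (p ^ N - p ^ k) := by ring
    rw [h1', h5]
    generalize saalschutzTerm a b p N k = t
    generalize p ^ N - a * b * p ^ k = u at *
    generalize 1 - p ^ (k + 1) = v at *
    generalize 1 - p ^ (k + 1 + 1) = w at *
    field_simp

theorem sum_saalschutzTerm_recurrence (hp0 : p ≠ 0) (hp : ∀ i : ℕ, 0 < i → 1 - p ^ i ≠ 0)
    (hab : ∀ N ≤ M, ∀ j, p ^ N - a * b * p ^ j ≠ 0) {N : ℕ} (hN : N + 1 ≤ M) (k : ℕ) :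
    ∑ i ∈ range (k + 1),
      ((1 - p ^ (N + 1)) * (a * b - p ^ (N + 1)) * saalschutzTerm a b p (N + 1) i -
        (a - p ^ (N + 1)) * (b - p ^ (N + 1)) * saalschutzTerm a b p N i) =
      -(p ^ (N + 1) / p ^ k * (1 - a * p ^ k) * (1 - b * p ^ k) * saalschutzTerm a b p N k) := by
  induction k with
  | zero =>
    simp only [zero_add, sum_range_one, saalschutzTerm_zero, pow_zero]
    ring
  | succ k ih =>
    rw [sum_range_succ, ih, saalschutzTerm_succ_succ hp0 hp hab hN, saalschutzTerm_succ]
    have h2 := hp (k + 1) k.succ_pos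
    have h4 := hab N (by omega) k
    generalize saalschutzTerm a b p N k = t
    have hx : p ^ k ≠ 0 := pow_ne_zero _ hp0
    rw [pow_succ p k] at h2 ⊢
    rw [pow_succ p N]
    generalize p ^ k = x at *
    generalize p ^ N = y at *
    generalize hu : y - a * b * x = u at *
    generalize hv : 1 - x * p = v at *
    field_simp
    subst hu hv
    ring

theorem sum_saalschutzTerm (hp0 : p ≠ 0) (hp : ∀ i : ℕ, 0 < i → 1 - p ^ i ≠ 0)
    (hab : ∀ N ≤ M, ∀ j, p ^ N - a * b * p ^ j ≠ 0) {m N : ℕ} (hNm : N < m) (hN : N ≤ M) :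
    ∑ k ∈ range m, saalschutzTerm a b p N k =
      ∏ j ∈ range N, (a - p ^ (j + 1)) * (b - p ^ (j + 1)) /
        ((1 - p ^ (j + 1)) * (a * b - p ^ (j + 1))) := by
  induction N with
  | zero =>
    rw [prod_range_zero, sum_eq_single_of_mem 0 (mem_range.2 hNm)
      fun k _ hk => saalschutzTerm_eq_zero _ _ _ (Nat.pos_of_ne_zero hk), saalschutzTerm_zero]
  | succ N ih =>
    obtain ⟨m, rfl⟩ : ∃ l, m = l + 1 := ⟨m - 1, by omega⟩
    have h := sum_saalschutzTerm_recurrence hp0 hp hab hN m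
    rw [saalschutzTerm_eq_zero a b p (show N < m by omega), mul_zero, neg_zero,
      sum_sub_distrib, ← mul_sum, ← mul_sum, ih (by omega) (by omega)] at h
    have h1 := hp (N + 1) N.succ_pos
    have h2 : a * b - p ^ (N + 1) ≠ 0 := by
      have := hab (N + 1) hN 0
      rw [pow_zero, mul_one] at this
      rwa [← neg_sub, neg_ne_zero]
    rw [prod_range_succ, ← mul_div_assoc, eq_div_iff (mul_ne_zero h1 h2)]
    linear_combination h

end Saalschutz

section LocalRing

/-- The rational functions whose denominator is coprime to `P`. -/
def coprimeDenom (P : ℚ[X]) : Subring (RatFunc ℚ) where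
  carrier := {A | ∃ f d : ℚ[X], IsCoprime d P ∧ d ≠ 0 ∧
    A * algebraMap ℚ[X] (RatFunc ℚ) d = algebraMap ℚ[X] (RatFunc ℚ) f}
  mul_mem' := by
    rintro A B ⟨f, d, hd, h0, h⟩ ⟨f', d', hd', h0', h'⟩
    refine ⟨f * f', d * d', hd.mul_left hd', mul_ne_zero h0 h0', ?_⟩
    rw [map_mul, map_mul, ← h, ← h']
    ring
  one_mem' := ⟨1, 1, isCoprime_one_left, one_ne_zero, by simp⟩
  add_mem' := by
    rintro A B ⟨f, d, hd, h0, h⟩ ⟨f', d', hd', h0', h'⟩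
    refine ⟨f * d' + f' * d, d * d', hd.mul_left hd', mul_ne_zero h0 h0', ?_⟩
    rw [map_add, map_mul, map_mul, map_mul, ← h, ← h']
    ring
  zero_mem' := ⟨0, 1, isCoprime_one_left, one_ne_zero, by simp⟩
  neg_mem' := by
    rintro A ⟨f, d, hd, h0, h⟩
    exact ⟨-f, d, hd, h0, by rw [map_neg, ← h, neg_mul]⟩

theorem algebraMap_mem_coprimeDenom (P f : ℚ[X]) :
    algebraMap ℚ[X] (RatFunc ℚ) f ∈ coprimeDenom P :=
  ⟨f, 1, isCoprime_one_left, one_ne_zero, by simp⟩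

theorem inv_algebraMap_mem_coprimeDenom {P d : ℚ[X]} (hd : IsCoprime d P) (h0 : d ≠ 0) :
    (algebraMap ℚ[X] (RatFunc ℚ) d)⁻¹ ∈ coprimeDenom P :=
  ⟨1, d, hd, h0, by
    rw [map_one, inv_mul_cancel₀ (RatFunc.algebraMap_ne_zero h0)]⟩

theorem X_pow_mem_coprimeDenom (P : ℚ[X]) (m : ℕ) :
    (RatFunc.X : RatFunc ℚ) ^ m ∈ coprimeDenom P := by
  simpa using algebraMap_mem_coprimeDenom P (X ^ m)

theorem isCoprime_denom_of_mem_coprimeDenom {P : ℚ[X]} {A : RatFunc ℚ}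
    (hA : A ∈ coprimeDenom P) : IsCoprime A.denom P := by
  obtain ⟨f, d, hd, h0, h⟩ := hA
  refine hd.of_isCoprime_of_dvd_left (RatFunc.denom_dvd h0 |>.2 ⟨f, ?_⟩)
  rw [← h, mul_div_cancel_right₀ _ (RatFunc.algebraMap_ne_zero h0)]

/-- `A` and `B` differ by a multiple of `P` in the ring of rational functions with denominator
coprime to `P`. -/
def RatCongr (P : ℚ[X]) (A B : RatFunc ℚ) : Prop :=
  ∃ C ∈ coprimeDenom P, A - B = algebraMap ℚ[X] (RatFunc ℚ) P * C

namespace RatCongr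

variable {P : ℚ[X]} {A B A' B' : RatFunc ℚ}

theorem congrZero (h : RatCongr P A 0) : CongrZero A P := by
  obtain ⟨C, hC, h⟩ := h
  exact ⟨C, by rw [← h, sub_zero], isCoprime_denom_of_mem_coprimeDenom hC⟩

theorem refl (A : RatFunc ℚ) : RatCongr P A A := ⟨0, zero_mem _, by simp⟩

theorem trans {C : RatFunc ℚ} (h : RatCongr P A B) (h' : RatCongr P B C) : RatCongr P A C := by
  obtain ⟨D, hD, h⟩ := h
  obtain ⟨D', hD', h'⟩ := h'
  exact ⟨D + D', add_mem hD hD', by linear_combination h + h'⟩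

theorem add (h : RatCongr P A B) (h' : RatCongr P A' B') : RatCongr P (A + A') (B + B') := by
  obtain ⟨D, hD, h⟩ := h
  obtain ⟨D', hD', h'⟩ := h'
  exact ⟨D + D', add_mem hD hD', by linear_combination h + h'⟩

theorem mul (h : RatCongr P A B) (h' : RatCongr P A' B') (hA : A ∈ coprimeDenom P)
    (hB' : B' ∈ coprimeDenom P) : RatCongr P (A * A') (B * B') := by
  obtain ⟨D, hD, h⟩ := h
  obtain ⟨D', hD', h'⟩ := h'
  exact ⟨A * D' + D * B', add_mem (mul_mem hA hD') (mul_mem hD hB'),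
    by linear_combination B' * h + A * h'⟩

theorem sum {s : Finset ℕ} {f g : ℕ → RatFunc ℚ} (h : ∀ k ∈ s, RatCongr P (f k) (g k)) :
    RatCongr P (∑ k ∈ s, f k) (∑ k ∈ s, g k) := by
  induction s using Finset.cons_induction with
  | empty => exact refl 0
  | cons a s ha ih =>
    rw [sum_cons, sum_cons]
    exact (h a (mem_cons_self a s)).add (ih fun k hk => h k (mem_cons_of_mem hk))

theorem prod {s : Finset ℕ} {f g : ℕ → RatFunc ℚ} (h : ∀ k ∈ s, RatCongr P (f k) (g k))
    (hf : ∀ k ∈ s, f k ∈ coprimeDenom P) (hg : ∀ k ∈ s, g k ∈ coprimeDenom P) :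
    RatCongr P (∏ k ∈ s, f k) (∏ k ∈ s, g k) := by
  induction s using Finset.cons_induction with
  | empty => exact refl 1
  | cons a s ha ih =>
    rw [prod_cons, prod_cons]
    exact (h a (mem_cons_self a s)).mul
      (ih (fun k hk => h k (mem_cons_of_mem hk)) (fun k hk => hf k (mem_cons_of_mem hk))
        fun k hk => hg k (mem_cons_of_mem hk))
      (hf a (mem_cons_self a s)) (prod_mem fun k hk => hg k (mem_cons_of_mem hk))

end RatCongr

end LocalRing

section Cyclotomic

theorem isCoprime_one_sub_X_pow_cyclotomic {n m : ℕ} (hm : 0 < m) (h : ¬ n ∣ m) :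
    IsCoprime (1 - X ^ m : ℚ[X]) (cyclotomic n ℚ) := by
  rw [← neg_sub, IsCoprime.neg_left_iff, ← prod_cyclotomic_eq_X_pow_sub_one hm]
  refine IsCoprime.prod_left fun d hd => cyclotomic.isCoprime_rat ?_
  rintro rfl
  exact h (Nat.dvd_of_mem_divisors hd)

theorem isCoprime_X_cyclotomic {n : ℕ} (hn : 0 < n) : IsCoprime (X : ℚ[X]) (cyclotomic n ℚ) := by
  have h : IsCoprime (X : ℚ[X]) (X ^ n - 1) := by
    refine ⟨X ^ (n - 1), -1, ?_⟩
    rw [← pow_succ, Nat.sub_add_cancel hn]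
    ring
  exact h.of_isCoprime_of_dvd_right (cyclotomic.dvd_X_pow_sub_one n ℚ)

theorem one_sub_X_pow_ne_zero {m : ℕ} (hm : 0 < m) : (1 - X ^ m : ℚ[X]) ≠ 0 := by
  rw [← neg_sub, neg_ne_zero]
  simpa using X_pow_sub_C_ne_zero hm (1 : ℚ)

theorem algebraMap_one_sub_X_pow (m : ℕ) :
    algebraMap ℚ[X] (RatFunc ℚ) (1 - X ^ m) = 1 - RatFunc.X ^ m := by simp

theorem one_sub_ratFuncX_pow_ne_zero {m : ℕ} (hm : 0 < m) :
    (1 - RatFunc.X ^ m : RatFunc ℚ) ≠ 0 := by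
  rw [← algebraMap_one_sub_X_pow]
  exact RatFunc.algebraMap_ne_zero (one_sub_X_pow_ne_zero hm)

theorem inv_one_sub_X_pow_mem {n m : ℕ} (hm : 0 < m) (h : ¬ n ∣ m) :
    (1 - RatFunc.X ^ m : RatFunc ℚ)⁻¹ ∈ coprimeDenom (cyclotomic n ℚ ^ 2) := by
  rw [← algebraMap_one_sub_X_pow]
  exact inv_algebraMap_mem_coprimeDenom (isCoprime_one_sub_X_pow_cyclotomic hm h).pow_right
    (one_sub_X_pow_ne_zero hm)

theorem inv_X_pow_mem {n : ℕ} (hn : 0 < n) (m : ℕ) :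
    ((RatFunc.X : RatFunc ℚ) ^ m)⁻¹ ∈ coprimeDenom (cyclotomic n ℚ ^ 2) := by
  have := inv_algebraMap_mem_coprimeDenom (isCoprime_X_cyclotomic hn).pow_left.pow_right
    (pow_ne_zero m X_ne_zero) (P := cyclotomic n ℚ ^ 2) (d := X ^ m)
  simpa using this

theorem exists_one_sub_X_pow_eq {n m : ℕ} (h : n ∣ m) (P : ℚ[X]) :
    ∃ C ∈ coprimeDenom P, (1 - RatFunc.X ^ m : RatFunc ℚ) =
      algebraMap ℚ[X] (RatFunc ℚ) (cyclotomic n ℚ) * C := by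
  obtain ⟨l, rfl⟩ := h
  obtain ⟨g, hg⟩ : cyclotomic n ℚ ∣ 1 - X ^ (n * l) := by
    rw [← neg_sub, dvd_neg]
    refine (cyclotomic.dvd_X_pow_sub_one n ℚ).trans ?_
    rw [pow_mul]
    exact sub_one_dvd_pow_sub_one _ _
  exact ⟨_, algebraMap_mem_coprimeDenom P g, by
    rw [← algebraMap_one_sub_X_pow, hg, map_mul]⟩

theorem exists_prod_eq_mul {P : ℚ[X]} {F : RatFunc ℚ} {s : Finset ℕ} {f : ℕ → RatFunc ℚ}
    (hf : ∀ j ∈ s, f j ∈ coprimeDenom P) {i : ℕ} (hi : i ∈ s)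
    (hF : ∃ C ∈ coprimeDenom P, f i = F * C) :
    ∃ C ∈ coprimeDenom P, ∏ j ∈ s, f j = F * C := by
  obtain ⟨C, hC, h⟩ := hF
  refine ⟨C * ∏ j ∈ s.erase i, f j,
    mul_mem hC (prod_mem fun j hj => hf j (mem_of_mem_erase hj)), ?_⟩
  rw [← mul_prod_erase s f hi, h, mul_assoc]

theorem not_dvd_nine_mul {n j : ℕ} (h9 : n.Coprime 9) (h0 : 0 < j) (hj : j < n) : ¬ n ∣ 9 * j :=
  fun h => Nat.not_dvd_of_pos_of_lt h0 hj (h9.dvd_of_dvd_mul_left h)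

theorem ratFuncX_pow_sub_ne_zero {l m : ℕ} (h : l < m) :
    (RatFunc.X : RatFunc ℚ) ^ l - RatFunc.X ^ m ≠ 0 := by
  obtain ⟨d, rfl⟩ := Nat.exists_eq_add_of_lt h
  rw [add_assoc, pow_add, ← mul_one_sub]
  exact mul_ne_zero (pow_ne_zero _ RatFunc.X_ne_zero) (one_sub_ratFuncX_pow_ne_zero d.succ_pos)

theorem ratCongr_saalschutzTerm {n N : ℕ} (hn : 0 < n) (h9 : n.Coprime 9) (hN : n ∣ 9 * N + 2)
    {k : ℕ} (hk : k < n) :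
    RatCongr (cyclotomic n ℚ ^ 2)
      (qPoch ((RatFunc.X : RatFunc ℚ) ^ (2 : ℤ)) (RatFunc.X ^ 9) k
            * qPoch ((RatFunc.X : RatFunc ℚ) ^ (2 : ℤ)) (RatFunc.X ^ 9) k
            * qPoch ((RatFunc.X : RatFunc ℚ) ^ (5 : ℤ)) (RatFunc.X ^ 9) k
            * RatFunc.X ^ (9 * k)
          / (qPoch ((RatFunc.X : RatFunc ℚ) ^ 9) (RatFunc.X ^ 9) k) ^ 3)
      (saalschutzTerm (RatFunc.X ^ 5) (RatFunc.X ^ (9 * N + 4)) (RatFunc.X ^ 9) N k) := by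
  have key : ∀ j ∈ range k, (1 - RatFunc.X ^ (9 * (j + 1)) : RatFunc ℚ)⁻¹ ∈
      coprimeDenom (cyclotomic n ℚ ^ 2) := fun j hj =>
    inv_one_sub_X_pow_mem (by omega)
      (not_dvd_nine_mul h9 j.succ_pos (by have := mem_range.1 hj; omega))
  have hz := inv_X_pow_mem hn (9 * N + 2)
  have hX := X_pow_mem_coprimeDenom (cyclotomic n ℚ ^ 2)
  obtain ⟨C, hC, hΦ⟩ := exists_one_sub_X_pow_eq hN (cyclotomic n ℚ ^ 2)
  have hg : ∀ j ∈ range k, (1 - RatFunc.X ^ (9 * j + 5)) * RatFunc.X ^ 9 *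
      (1 - RatFunc.X ^ (9 * (j + 1)) : RatFunc ℚ)⁻¹ ^ 3 ∈ coprimeDenom (cyclotomic n ℚ ^ 2) :=
    fun j hj => mul_mem (mul_mem (sub_mem (one_mem _) (hX _)) (hX _)) (pow_mem (key j hj) 3)
  have h1 : qPoch ((RatFunc.X : RatFunc ℚ) ^ (2 : ℤ)) (RatFunc.X ^ 9) k
            * qPoch ((RatFunc.X : RatFunc ℚ) ^ (2 : ℤ)) (RatFunc.X ^ 9) k
            * qPoch ((RatFunc.X : RatFunc ℚ) ^ (5 : ℤ)) (RatFunc.X ^ 9) k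
            * RatFunc.X ^ (9 * k)
          / (qPoch ((RatFunc.X : RatFunc ℚ) ^ 9) (RatFunc.X ^ 9) k) ^ 3 =
      ∏ j ∈ range k, (1 - RatFunc.X ^ (9 * j + 5)) * RatFunc.X ^ 9 *
        (1 - RatFunc.X ^ (9 * (j + 1)) : RatFunc ℚ)⁻¹ ^ 3 * (1 - RatFunc.X ^ (9 * j + 2)) ^ 2 := by
    have hk9 : (RatFunc.X : RatFunc ℚ) ^ (9 * k) = ∏ j ∈ range k, RatFunc.X ^ 9 := by
      rw [prod_const, card_range, pow_mul]
    simp only [qPoch]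
    rw [hk9, ← prod_pow, ← prod_mul_distrib, ← prod_mul_distrib, ← prod_mul_distrib,
      ← prod_div_distrib]
    refine prod_congr rfl fun j _ => ?_
    have e2 : (RatFunc.X : RatFunc ℚ) ^ (2 : ℤ) * (RatFunc.X ^ 9) ^ j =
        RatFunc.X ^ (9 * j + 2) := by
      rw [zpow_ofNat]; ring
    have e5 : (RatFunc.X : RatFunc ℚ) ^ (5 : ℤ) * (RatFunc.X ^ 9) ^ j =
        RatFunc.X ^ (9 * j + 5) := by
      rw [zpow_ofNat]; ring
    have e9 : (RatFunc.X : RatFunc ℚ) ^ 9 * (RatFunc.X ^ 9) ^ j = RatFunc.X ^ (9 * (j + 1)) := by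
      ring
    rw [e2, e5, e9, div_eq_mul_inv, inv_pow]
    ring
  have h2 : saalschutzTerm (RatFunc.X ^ 5) (RatFunc.X ^ (9 * N + 4)) (RatFunc.X ^ 9 : RatFunc ℚ) N
      k = ∏ j ∈ range k, (1 - RatFunc.X ^ (9 * j + 5)) * RatFunc.X ^ 9 *
        (1 - RatFunc.X ^ (9 * (j + 1)) : RatFunc ℚ)⁻¹ ^ 3 *
        ((1 - RatFunc.X ^ (9 * j + 2) * RatFunc.X ^ (9 * N + 2)) *
          (1 - RatFunc.X ^ (9 * j + 2) * (RatFunc.X ^ (9 * N + 2))⁻¹)) := by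
    refine prod_congr rfl fun j _ => ?_
    have hv := one_sub_ratFuncX_pow_ne_zero (show 0 < 9 * (j + 1) by omega)
    have hy : (RatFunc.X ^ (9 * N) : RatFunc ℚ) ≠ 0 := pow_ne_zero _ RatFunc.X_ne_zero
    have hx : (RatFunc.X : RatFunc ℚ) ≠ 0 := RatFunc.X_ne_zero
    have e1 : (RatFunc.X ^ 9 : RatFunc ℚ) ^ N - RatFunc.X ^ 5 * RatFunc.X ^ (9 * N + 4) *
        (RatFunc.X ^ 9) ^ j = RatFunc.X ^ (9 * N) * (1 - RatFunc.X ^ (9 * (j + 1))) := by ring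
    have e2 : (RatFunc.X ^ 9 : RatFunc ℚ) ^ (j + 1) = RatFunc.X ^ (9 * (j + 1)) := by ring
    rw [e1, e2]
    generalize (1 - RatFunc.X ^ (9 * (j + 1)) : RatFunc ℚ) = v at *
    simp only [pow_add, ← pow_mul] at hy ⊢
    generalize (RatFunc.X ^ (9 * N) : RatFunc ℚ) = y at *
    generalize (RatFunc.X ^ (9 * j) : RatFunc ℚ) = x at *
    field_simp
  rw [h1, h2]
  refine RatCongr.prod (fun j hj => ?_) (fun j hj => ?_) fun j hj => ?_
  · refine ⟨(1 - RatFunc.X ^ (9 * j + 5)) * RatFunc.X ^ 9 *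
      (1 - RatFunc.X ^ (9 * (j + 1)) : RatFunc ℚ)⁻¹ ^ 3 *
      (RatFunc.X ^ (9 * j + 2) * (RatFunc.X ^ (9 * N + 2))⁻¹ * C ^ 2),
      mul_mem (hg j hj) (mul_mem (mul_mem (hX _) hz) (pow_mem hC 2)), ?_⟩
    have hy : (RatFunc.X ^ (9 * N + 2) : RatFunc ℚ) * (RatFunc.X ^ (9 * N + 2))⁻¹ = 1 :=
      mul_inv_cancel₀ (pow_ne_zero _ RatFunc.X_ne_zero)
    rw [map_pow]
    generalize (RatFunc.X ^ (9 * N + 2) : RatFunc ℚ)⁻¹ = w at *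
    generalize (RatFunc.X ^ (9 * N + 2) : RatFunc ℚ) = z at *
    generalize (RatFunc.X ^ (9 * j + 2) : RatFunc ℚ) = x at *
    generalize (1 - RatFunc.X ^ (9 * j + 5)) * RatFunc.X ^ 9 *
      (1 - RatFunc.X ^ (9 * (j + 1)) : RatFunc ℚ)⁻¹ ^ 3 = g at *
    generalize algebraMap ℚ[X] (RatFunc ℚ) (cyclotomic n ℚ) = F at *
    linear_combination g * (2 * x - x * z - x ^ 2) * hy + g * x * w * (1 - z + F * C) * hΦ
  · exact mul_mem (hg j hj) (pow_mem (sub_mem (one_mem _) (hX _)) 2)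
  · exact mul_mem (hg j hj) (mul_mem (sub_mem (one_mem _) (mul_mem (hX _) (hX _)))
      (sub_mem (one_mem _) (mul_mem (hX _) hz)))

theorem ratCongr_sum_saalschutzTerm {n N i j : ℕ} (h9 : n.Coprime 9) (hNn : N < n)
    (hN : n ∣ 9 * N + 2) (hi : i < N) (hin : n ∣ 9 * i + 4) (hj : j < N) (hjn : n ∣ 9 * j + 7) :
    RatCongr (cyclotomic n ℚ ^ 2)
      (∑ k ∈ range n,
        saalschutzTerm (RatFunc.X ^ 5) (RatFunc.X ^ (9 * N + 4)) (RatFunc.X ^ 9) N k) 0 := by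
  have hX := X_pow_mem_coprimeDenom (cyclotomic n ℚ ^ 2)
  have key : ∀ l, 0 < l → l < n → (1 - RatFunc.X ^ (9 * l) : RatFunc ℚ)⁻¹ ∈
      coprimeDenom (cyclotomic n ℚ ^ 2) := fun l h0 hl =>
    inv_one_sub_X_pow_mem (by omega) (not_dvd_nine_mul h9 h0 hl)
  obtain ⟨C, hC, h1⟩ := exists_prod_eq_mul
    (f := fun l => RatFunc.X ^ 5 * (1 - RatFunc.X ^ (9 * l + 4))) (P := cyclotomic n ℚ ^ 2)
    (F := algebraMap ℚ[X] (RatFunc ℚ) (cyclotomic n ℚ))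
    (fun l _ => mul_mem (hX 5) (sub_mem (one_mem _) (hX _))) (mem_range.2 hi) (by
      obtain ⟨C, hC, h⟩ := exists_one_sub_X_pow_eq hin (cyclotomic n ℚ ^ 2)
      exact ⟨RatFunc.X ^ 5 * C, mul_mem (hX 5) hC, by rw [h]; ring⟩)
  have hB : ∀ l ∈ range N, (1 - RatFunc.X ^ (9 * (l + 1)) : RatFunc ℚ)⁻¹ *
      (1 - RatFunc.X ^ (9 * (N - l)))⁻¹ ∈ coprimeDenom (cyclotomic n ℚ ^ 2) := fun l hl => by
    have := mem_range.1 hl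
    exact mul_mem (key _ (by omega) (by omega)) (key _ (by omega) (by omega))
  obtain ⟨C', hC', h2⟩ := exists_prod_eq_mul
    (f := fun l => (1 - RatFunc.X ^ (9 * (N - l) - 5)) *
      ((1 - RatFunc.X ^ (9 * (l + 1)) : RatFunc ℚ)⁻¹ * (1 - RatFunc.X ^ (9 * (N - l)))⁻¹))
    (P := cyclotomic n ℚ ^ 2) (F := algebraMap ℚ[X] (RatFunc ℚ) (cyclotomic n ℚ))
    (fun l hl => mul_mem (sub_mem (one_mem _) (hX _)) (hB l hl)) (mem_range.2 hj) (by
      have hd : n ∣ 9 * (N - j) - 5 := by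
        have := Nat.dvd_sub hN hjn
        rwa [show 9 * N + 2 - (9 * j + 7) = 9 * (N - j) - 5 by omega] at this
      obtain ⟨C, hC, h⟩ := exists_one_sub_X_pow_eq hd (cyclotomic n ℚ ^ 2)
      exact ⟨_, mul_mem hC (hB j (mem_range.2 hj)), by rw [h, mul_assoc]⟩)
  refine ⟨C * C', mul_mem hC hC', ?_⟩
  have h3 := sum_saalschutzTerm (K := RatFunc ℚ) (p := RatFunc.X ^ 9) (a := RatFunc.X ^ 5)
    (b := RatFunc.X ^ (9 * N + 4)) (M := N) (pow_ne_zero _ RatFunc.X_ne_zero)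
    (fun l hl => by rw [← pow_mul]; exact one_sub_ratFuncX_pow_ne_zero (by omega))
    (fun l hl j => by
      rw [← pow_mul, ← pow_mul, ← pow_add, ← pow_add]
      exact ratFuncX_pow_sub_ne_zero (by omega)) hNn le_rfl
  rw [h3, sub_zero, map_pow, sq, mul_mul_mul_comm, ← h1, ← h2, ← prod_mul_distrib]
  refine prod_congr rfl fun l hl => ?_
  obtain ⟨d, rfl⟩ := Nat.exists_eq_add_of_lt (mem_range.1 hl)
  rw [show l + d + 1 - l = d + 1 by omega, show 9 * (d + 1) - 5 = 9 * d + 4 by omega]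
  have hv := one_sub_ratFuncX_pow_ne_zero (show 0 < 9 * (l + 1) by omega)
  have hu := one_sub_ratFuncX_pow_ne_zero (show 0 < 9 * (d + 1) by omega)
  have hw : (RatFunc.X ^ (9 * (l + 1)) : RatFunc ℚ) ≠ 0 := pow_ne_zero _ RatFunc.X_ne_zero
  have e1 : (RatFunc.X ^ 5 * RatFunc.X ^ (9 * (l + d + 1) + 4) - (RatFunc.X ^ 9) ^ (l + 1) :
      RatFunc ℚ) = -(RatFunc.X ^ (9 * (l + 1)) * (1 - RatFunc.X ^ (9 * (d + 1)))) := by ring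
  have e2 : (RatFunc.X ^ (9 * (l + d + 1) + 4) - (RatFunc.X ^ 9) ^ (l + 1) :
      RatFunc ℚ) = -(RatFunc.X ^ (9 * (l + 1)) * (1 - RatFunc.X ^ (9 * d + 4))) := by ring
  have e3 : (RatFunc.X ^ 5 - (RatFunc.X ^ 9) ^ (l + 1) : RatFunc ℚ) =
      RatFunc.X ^ 5 * (1 - RatFunc.X ^ (9 * l + 4)) := by ring
  rw [e1, e2, e3, ← pow_mul]
  generalize (1 - RatFunc.X ^ (9 * (d + 1)) : RatFunc ℚ) = u at *
  generalize (1 - RatFunc.X ^ (9 * (l + 1)) : RatFunc ℚ) = v at *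
  generalize (RatFunc.X ^ (9 * (l + 1)) : RatFunc ℚ) = w at *
  field_simp

end Cyclotomic

theorem stmt13 (n : ℕ) (hn : 0 < n) (hmod : n % 9 = 4 ∨ n % 9 = 7) :
    CongrZero
      (∑ k ∈ Finset.range n,
        qPoch ((RatFunc.X : RatFunc ℚ) ^ (2 : ℤ)) (RatFunc.X ^ 9) k
            * qPoch ((RatFunc.X : RatFunc ℚ) ^ (2 : ℤ)) (RatFunc.X ^ 9) k
            * qPoch ((RatFunc.X : RatFunc ℚ) ^ (5 : ℤ)) (RatFunc.X ^ 9) k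
            * RatFunc.X ^ (9 * k)
          / (qPoch ((RatFunc.X : RatFunc ℚ) ^ 9) (RatFunc.X ^ 9) k) ^ 3)
      ((Polynomial.cyclotomic n ℚ) ^ 2) := by
  have h9 : n.Coprime 9 := by
    rw [Nat.coprime_comm, show 9 = 3 ^ 2 by norm_num]
    refine Nat.Coprime.pow_left 2 ((Nat.Prime.coprime_iff_not_dvd Nat.prime_three).2 ?_)
    omega
  obtain ⟨N, i, j, hNn, hN, hi, hin, hj, hjn⟩ : ∃ N i j, N < n ∧ n ∣ 9 * N + 2 ∧
      i < N ∧ n ∣ 9 * i + 4 ∧ j < N ∧ n ∣ 9 * j + 7 := by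
    rcases hmod with h | h
    · exact ⟨(5 * n - 2) / 9, (n - 4) / 9, (4 * n - 7) / 9, by omega, ⟨5, by omega⟩, by omega,
        ⟨1, by omega⟩, by omega, ⟨4, by omega⟩⟩
    · exact ⟨(8 * n - 2) / 9, (7 * n - 4) / 9, (n - 7) / 9, by omega, ⟨8, by omega⟩, by omega,
        ⟨7, by omega⟩, by omega, ⟨1, by omega⟩⟩
  exact ((RatCongr.sum fun k hk => ratCongr_saalschutzTerm hn h9 hN (mem_range.1 hk)).trans
    (ratCongr_sum_saalschutzTerm h9 hNn hN hi hin hj hjn)).congrZero
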